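/- arXiv:1605.08739 — 2 statements merged into one kernel-verified Lean document; each statement's English description precedes it below -/
import Mathlib

section
/- The angular gap between neighboring rays of the complete fan Σ_h tends to zero: for every δ > 0 there exists H such that for all h ≥ H and all primitive u, v ∈ ℤ² that are adjacent at height h, one has ‖ u/‖u‖ − v/‖v‖ ‖ ≤ δ (the normalized vectors being taken in ℝ² with the sup norm). -/
/-- A vector `u ∈ ℤ²` is primitive if it is nonzero and its coordinates are coprime. -/
def Primitive (u : ℤ × ℤ) : Prop := u ≠ 0 ∧ Int.gcd u.1 u.2 = 1

/-- The sup norm of a lattice vector, as a natural number. -/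
def hgt (u : ℤ × ℤ) : ℕ := max u.1.natAbs u.2.natAbs

/-- The determinant of the `2 × 2` matrix with columns `u` and `v`. -/
def det2 (u v : ℤ × ℤ) : ℤ := u.1 * v.2 - u.2 * v.1

/-- `w` lies in the open cone `{a·u + b·v : a, b ∈ ℝ, a > 0, b > 0}`. -/
def InOpenCone (u v w : ℤ × ℤ) : Prop :=
  ∃ a b : ℝ, 0 < a ∧ 0 < b ∧
    (w.1 : ℝ) = a * u.1 + b * v.1 ∧ (w.2 : ℝ) = a * u.2 + b * v.2

/-- `u` and `v` are adjacent at height `h`: they span a cone of the complete fan `Σ_h`. -/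
def Adjacent (h : ℕ) (u v : ℤ × ℤ) : Prop :=
  hgt u ≤ h ∧ hgt v ≤ h ∧ 0 < det2 u v ∧
    ∀ w : ℤ × ℤ, Primitive w → hgt w ≤ h → ¬ InOpenCone u v w

/-- The sup distance between the normalizations of two lattice vectors. -/
noncomputable def normalizedGap (u v : ℤ × ℤ) : ℝ :=
  max |(u.1 : ℝ) / (hgt u : ℝ) - (v.1 : ℝ) / (hgt v : ℝ)|
    |(u.2 : ℝ) / (hgt u : ℝ) - (v.2 : ℝ) / (hgt v : ℝ)|

/-- Rotation of the lattice plane by a quarter turn. -/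
def quarterTurn (u : ℤ × ℤ) : ℤ × ℤ := (-u.2, u.1)

/-- Reflection of the lattice plane in the first coordinate axis. -/
def reflectAxis (u : ℤ × ℤ) : ℤ × ℤ := (u.1, -u.2)

lemma hgt_quarterTurn (u : ℤ × ℤ) : hgt (quarterTurn u) = hgt u := by
  simp [hgt, quarterTurn, max_comm]

lemma hgt_reflectAxis (u : ℤ × ℤ) : hgt (reflectAxis u) = hgt u := by
  simp [hgt, reflectAxis]

lemma quarterTurn_add (u v : ℤ × ℤ) : quarterTurn (u + v) = quarterTurn u + quarterTurn v := by
  ext <;> simp [quarterTurn, add_comm]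

lemma reflectAxis_add (u v : ℤ × ℤ) : reflectAxis (u + v) = reflectAxis u + reflectAxis v := by
  ext <;> simp [reflectAxis, add_comm]

lemma det2_quarterTurn (u v : ℤ × ℤ) : det2 (quarterTurn u) (quarterTurn v) = det2 u v := by
  simp only [det2, quarterTurn]; ring

lemma det2_reflectAxis (u v : ℤ × ℤ) : det2 (reflectAxis v) (reflectAxis u) = det2 u v := by
  simp only [det2, reflectAxis]; ring

lemma normalizedGap_quarterTurn (u v : ℤ × ℤ) :
    normalizedGap (quarterTurn u) (quarterTurn v) = normalizedGap u v := by
  simp only [normalizedGap, hgt_quarterTurn]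
  simp only [quarterTurn, Int.cast_neg, neg_div]
  rw [max_comm, ← abs_neg (-((u.2 : ℝ) / hgt u) - _)]
  congr 2
  ring

lemma normalizedGap_reflectAxis (u v : ℤ × ℤ) :
    normalizedGap (reflectAxis v) (reflectAxis u) = normalizedGap u v := by
  simp only [normalizedGap, hgt_reflectAxis]
  simp only [reflectAxis, Int.cast_neg, neg_div]
  rw [abs_sub_comm]
  congr 2
  ring

/-- A vector that completes another one to a basis of `ℤ²` is primitive. -/
lemma primitive_of_det2_eq_one {u w : ℤ × ℤ} (h : det2 u w = 1) : Primitive w := by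
  refine ⟨?_, ?_⟩
  · rintro rfl
    simp [det2] at h
  · rw [← Int.isCoprime_iff_gcd_eq_one]
    refine ⟨-u.2, u.1, ?_⟩
    rw [← h, det2]
    ring

/-- If a unimodular pair has its longer vector on the right side of a square, and the sum of
the pair leaves that square, then the shorter vector also points to the right side. -/
lemma abs_le_of_unimodular {a b c d : ℤ} (ha : 2 ≤ a) (hb : |b| ≤ a) (hc : |c| ≤ a)
    (hd : |d| ≤ a) (hdet : a * d - b * c = 1) (hsum : a < |a + c| ∨ a < |b + d|) :
    |d| ≤ c := by
  rw [abs_le] at hb hc hd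
  rcases lt_trichotomy c 0 with h | h | h
  · have h1 : a < |b + d| := by
      rcases hsum with h1 | h1
      · rw [lt_abs] at h1; omega
      · exact h1
    rw [lt_abs] at h1
    rcases h1 with h1 | h1
    · have : 0 < b := by omega
      have : 0 < d := by omega
      nlinarith
    · have : b < 0 := by omega
      have : d < 0 := by omega
      nlinarith
  · subst h
    have : a ∣ 1 := ⟨d, by linarith⟩
    have := Int.le_of_dvd one_pos this
    omega
  · rw [abs_le]
    constructor
    · by_contra! hlt
      nlinarith
    · by_contra! hlt
      nlinarith

lemma normalizedGap_le_of_fst_eq_hgt {u v : ℤ × ℤ} (hu : 2 ≤ hgt u) (hfst : u.1 = hgt u)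
    (hvu : hgt v ≤ hgt u) (hdet : det2 u v = 1) (hsum : hgt u < hgt (u + v)) :
    normalizedGap u v ≤ 1 / hgt u := by
  have hv : |v.2| ≤ v.1 := by
    apply abs_le_of_unimodular (a := u.1) (b := u.2) _ _ _ _ hdet
    · simp only [hgt, Prod.fst_add, Prod.snd_add, Int.abs_eq_natAbs] at *
      omega
    all_goals simp only [hgt, Int.abs_eq_natAbs] at *; omega
  have hvfst : v.1 = hgt v := by
    simp only [hgt]
    rw [Int.abs_eq_natAbs] at hv
    omega
  have hvpos : 1 ≤ hgt v := by
    by_contra! h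
    have h1 : v.1 = 0 := by omega
    have h2 : v.2 = 0 := by rw [h1] at hv; simpa using hv
    simp [det2, h1, h2] at hdet
  have hp : (0 : ℝ) < hgt u := by exact_mod_cast (by omega : 0 < hgt u)
  have hq : (1 : ℝ) ≤ hgt v := by exact_mod_cast hvpos
  have hq' : (0 : ℝ) < hgt v := by linarith
  have e1 : (u.1 : ℝ) = hgt u := by exact_mod_cast hfst
  have e2 : (v.1 : ℝ) = hgt v := by exact_mod_cast hvfst
  have hdet' : (hgt u : ℝ) * v.2 - u.2 * hgt v = 1 := by
    rw [← e1, ← e2]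
    exact_mod_cast hdet
  have e3 : (u.2 : ℝ) / hgt u - v.2 / hgt v = -(1 / (hgt u * hgt v)) := by
    field_simp
    linarith
  rw [normalizedGap, e1, e2, e3, div_self hp.ne', div_self hq'.ne', sub_self, abs_zero, abs_neg,
    abs_of_pos (by positivity)]
  apply max_le (by positivity)
  apply one_div_le_one_div_of_le hp
  nlinarith

lemma normalizedGap_le_of_hgt_le {u v : ℤ × ℤ} (hu : 2 ≤ hgt u)
    (hvu : hgt v ≤ hgt u) (hdet : det2 u v = 1) (hsum : hgt u < hgt (u + v)) :
    normalizedGap u v ≤ 1 / hgt u := by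
  have key : ∀ n : ℕ, ∀ u v : ℤ × ℤ, ((quarterTurn^[n]) u).1 = hgt u → 2 ≤ hgt u →
      hgt v ≤ hgt u → det2 u v = 1 → hgt u < hgt (u + v) → normalizedGap u v ≤ 1 / hgt u := by
    intro n
    induction n with
    | zero =>
      intro u v h hu hvu hdet hsum
      exact normalizedGap_le_of_fst_eq_hgt hu h hvu hdet hsum
    | succ n ih =>
      intro u v h hu hvu hdet hsum
      have := ih (quarterTurn u) (quarterTurn v)
      rw [← quarterTurn_add, hgt_quarterTurn, hgt_quarterTurn, hgt_quarterTurn, det2_quarterTurn,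
        normalizedGap_quarterTurn] at this
      exact this h hu hvu hdet hsum
  have hcases : u.1 = hgt u ∨ -u.2 = hgt u ∨ -u.1 = hgt u ∨ u.2 = hgt u := by
    simp only [hgt]; omega
  rcases hcases with h | h | h | h
  · exact key 0 u v h hu hvu hdet hsum
  · exact key 1 u v h hu hvu hdet hsum
  · exact key 2 u v h hu hvu hdet hsum
  · exact key 3 u v (by simpa [quarterTurn] using h) hu hvu hdet hsum

/-- The normalized vectors of a unimodular pair whose sum is longer than both are close. -/
lemma normalizedGap_le {u v : ℤ × ℤ} (h2 : 2 ≤ max (hgt u) (hgt v)) (hdet : det2 u v = 1)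
    (hsum : max (hgt u) (hgt v) < hgt (u + v)) :
    normalizedGap u v ≤ 1 / (max (hgt u) (hgt v) : ℕ) := by
  rcases le_total (hgt v) (hgt u) with h | h
  · rw [max_eq_left h] at *
    exact normalizedGap_le_of_hgt_le h2 h hdet hsum
  · rw [max_eq_right h] at *
    rw [← normalizedGap_reflectAxis, ← hgt_reflectAxis v]
    apply normalizedGap_le_of_hgt_le
    · rwa [hgt_reflectAxis]
    · rwa [hgt_reflectAxis, hgt_reflectAxis]
    · rwa [det2_reflectAxis]
    · rwa [← reflectAxis_add, hgt_reflectAxis, hgt_reflectAxis, add_comm]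

lemma exists_det2_eq_one {u : ℤ × ℤ} (hu : Primitive u) : ∃ x, det2 u x = 1 := by
  obtain ⟨a, b, hab⟩ := Int.isCoprime_iff_gcd_eq_one.mpr hu.2
  exact ⟨(-b, a), by simp only [det2]; linarith⟩

lemma abs_le_of_mul_eq_add {D k s t w h : ℤ} (hk : 0 ≤ k) (hkD : k + 1 ≤ D)
    (hs : |s| ≤ h) (ht : |t| ≤ h) (hw : D * w = k * s + t) : |w| ≤ h := by
  rw [abs_le] at *
  have hD : 0 < D := by omega
  have hh : 0 ≤ h := by omega
  constructor
  · apply le_of_mul_le_mul_left _ hD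
    nlinarith
  · apply le_of_mul_le_mul_left _ hD
    nlinarith

/-- Adjacent primitive vectors form a basis of `ℤ²`. -/
lemma Adjacent.det2_eq_one {h : ℕ} {u v : ℤ × ℤ} (hadj : Adjacent h u v) (hu : Primitive u)
    (hv : Primitive v) : det2 u v = 1 := by
  obtain ⟨huh, hvh, hpos, hempty⟩ := hadj
  by_contra hne
  obtain ⟨x, hx⟩ := exists_det2_eq_one hu
  set D := det2 u v with hD
  set α := det2 v x with hα
  have hv1 : v.1 = α * u.1 + D * x.1 := by
    simp only [det2] at *
    linear_combination (-v.1) * hx - u.1 * hα - x.1 * hD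
  have hv2 : v.2 = α * u.2 + D * x.2 := by
    simp only [det2] at *
    linear_combination (-v.2) * hx - u.2 * hα - x.2 * hD
  have hr : α % D ≠ 0 := by
    intro h0
    have hdvd : D ∣ α := Int.dvd_of_emod_eq_zero h0
    have h1 : D ∣ v.1 := hv1 ▸ (hdvd.mul_right _).add (dvd_mul_right _ _)
    have h2 : D ∣ v.2 := hv2 ▸ (hdvd.mul_right _).add (dvd_mul_right _ _)
    have h3 := Int.dvd_coe_gcd h1 h2
    rw [hv.2] at h3
    have := Int.le_of_dvd (by norm_num) h3
    norm_num at this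
    omega
  have hr0 := Int.emod_nonneg α hpos.ne'
  have hrD := Int.emod_lt_of_pos α hpos
  have hdiv := Int.emod_add_mul_ediv α D
  let w : ℤ × ℤ := (x.1 + (α / D + 1) * u.1, x.2 + (α / D + 1) * u.2)
  have hw1 : D * w.1 = (D - α % D) * u.1 + v.1 := by
    simp only [w]
    linear_combination u.1 * hdiv - hv1
  have hw2 : D * w.2 = (D - α % D) * u.2 + v.2 := by
    simp only [w]
    linear_combination u.2 * hdiv - hv2
  have hdet : det2 u w = 1 := by
    rw [← hx]
    simp only [det2, w]
    ring
  have hDR : (0 : ℝ) < D := by exact_mod_cast hpos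
  refine hempty w (primitive_of_det2_eq_one hdet) ?_ ?_
  · have b1 : |w.1| ≤ (h : ℤ) := by
      refine abs_le_of_mul_eq_add (by omega) (by omega) ?_ ?_ hw1 <;>
        simp only [hgt, Int.abs_eq_natAbs] at * <;> omega
    have b2 : |w.2| ≤ (h : ℤ) := by
      refine abs_le_of_mul_eq_add (by omega) (by omega) ?_ ?_ hw2 <;>
        simp only [hgt, Int.abs_eq_natAbs] at * <;> omega
    simp only [hgt, Int.abs_eq_natAbs] at *
    omega
  · refine ⟨((D - α % D : ℤ) : ℝ) / D, 1 / D, ?_, by positivity, ?_, ?_⟩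
    · apply div_pos _ hDR
      exact_mod_cast (by omega : 0 < D - α % D)
    · have : (D : ℝ) * w.1 = ((D - α % D : ℤ) : ℝ) * u.1 + v.1 := by exact_mod_cast hw1
      field_simp
      linarith
    · have : (D : ℝ) * w.2 = ((D - α % D : ℤ) : ℝ) * u.2 + v.2 := by exact_mod_cast hw2
      field_simp
      linarith

lemma Adjacent.lt_hgt_add {h : ℕ} {u v : ℤ × ℤ} (hadj : Adjacent h u v)
    (hdet : det2 u v = 1) : h < hgt (u + v) := by
  by_contra! hle
  refine hadj.2.2.2 (u + v) (primitive_of_det2_eq_one (u := u) ?_) hle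
    ⟨1, 1, one_pos, one_pos, by simp, by simp⟩
  rw [← hdet]
  simp only [det2, Prod.fst_add, Prod.snd_add]
  ring

lemma hgt_add_le (u v : ℤ × ℤ) : hgt (u + v) ≤ hgt u + hgt v := by
  simp only [hgt, Prod.fst_add, Prod.snd_add]
  omega

/-- The angular gap between neighboring rays of `Σ_h` goes to zero as `h → ∞`. -/
theorem angular_gap_small (δ : ℝ) (hδ : 0 < δ) :
    ∃ H : ℕ, ∀ h : ℕ, H ≤ h → ∀ u v : ℤ × ℤ, Primitive u → Primitive v →
      Adjacent h u v →
      max |(u.1 : ℝ) / (hgt u : ℝ) - (v.1 : ℝ) / (hgt v : ℝ)|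
          |(u.2 : ℝ) / (hgt u : ℝ) - (v.2 : ℝ) / (hgt v : ℝ)| ≤ δ := by
  obtain ⟨N, hN⟩ := exists_nat_gt (2 / δ)
  refine ⟨max N 4, fun h hh u v hu hv hadj => ?_⟩
  have hdet := hadj.det2_eq_one hu hv
  have hsum := hadj.lt_hgt_add hdet
  have hadd := hgt_add_le u v
  obtain ⟨huh, hvh, -, -⟩ := hadj
  refine (normalizedGap_le (by omega) hdet (by omega)).trans ?_
  have hm : (N : ℝ) ≤ 2 * (max (hgt u) (hgt v) : ℕ) := by
    exact_mod_cast (by omega : N ≤ 2 * max (hgt u) (hgt v))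
  have hmpos : (0 : ℝ) < (max (hgt u) (hgt v) : ℕ) := by
    exact_mod_cast (by omega : 0 < max (hgt u) (hgt v))
  rw [div_lt_iff₀ hδ] at hN
  rw [div_le_iff₀ hmpos]
  nlinarith
end

section
/- Main Theorem, part 2 (singularity threshold): Let q : ℕ → ℝ with 0 ≤ q(h) ≤ 1 for all h. If h²·q(h) → ∞ and h²·(1 − q(h)) → ∞ as h → ∞, then P_{h,1−q(h)}({S ⊆ R_h : some S-adjacent pair u, v has det(u,v) ≥ 2}) → 1 as h → ∞. That is, with high probability the toric surface of a random fan drawn from T(h, 1 − q(h)) is singular. -/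
open Filter Topology

open Classical in
/-- The set of primitive vectors of sup norm at most `h` (the rays of the complete fan `Σ_h`). -/
noncomputable def rays (h : ℕ) : Finset (ℤ × ℤ) :=
  (Finset.Icc (-(h : ℤ), -(h : ℤ)) ((h : ℤ), (h : ℤ))).filter (fun u => Primitive u)

/-- `u` and `v` are `S`-adjacent: both lie in `S`, `det(u,v) > 0`, and no element of `S`
lies in the open cone between them.  `S`-adjacent pairs span the 2-dimensional cones of
the completed fan of `S`. -/
def SAdj (S : Finset (ℤ × ℤ)) (u v : ℤ × ℤ) : Prop :=
  u ∈ S ∧ v ∈ S ∧ 0 < det2 u v ∧ ∀ w ∈ S, ¬ InOpenCone u v w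

open Classical in
/-- The probability, under the distribution `T(h, p)` (each ray of `Σ_h` kept
independently with probability `p`), of the set of fans whose ray set satisfies `A`. -/
noncomputable def prob (h : ℕ) (p : ℝ) (A : Finset (ℤ × ℤ) → Prop) : ℝ :=
  ∑ S ∈ (rays h).powerset,
    if A S then p ^ S.card * (1 - p) ^ ((rays h).card - S.card) else 0


section RandomSubset

variable {α ι : Type*}

/-- The expectation of `f S`, where `S` keeps each element of `R` independently with
probability `p`. -/
noncomputable def expect (R : Finset α) (p : ℝ) (f : Finset α → ℝ) : ℝ :=
  ∑ S ∈ R.powerset, p ^ S.card * (1 - p) ^ (R.card - S.card) * f S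

lemma expect_add (R : Finset α) (p : ℝ) (f g : Finset α → ℝ) :
    expect R p (fun S => f S + g S) = expect R p f + expect R p g := by
  simp [expect, mul_add, Finset.sum_add_distrib]

lemma expect_const_mul (R : Finset α) (p c : ℝ) (f : Finset α → ℝ) :
    expect R p (fun S => c * f S) = c * expect R p f := by
  simp only [expect, Finset.mul_sum]
  exact Finset.sum_congr rfl fun S _ => by ring

lemma expect_sum (R : Finset α) (p : ℝ) (I : Finset ι) (f : ι → Finset α → ℝ) :
    expect R p (fun S => ∑ i ∈ I, f i S) = ∑ i ∈ I, expect R p (f i) := by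
  simp only [expect, Finset.mul_sum]
  exact Finset.sum_comm

lemma expect_mono {R : Finset α} {p : ℝ} (h0 : 0 ≤ p) (h1 : p ≤ 1) {f g : Finset α → ℝ}
    (hfg : ∀ S ⊆ R, f S ≤ g S) : expect R p f ≤ expect R p g := by
  refine Finset.sum_le_sum fun S hS => ?_
  have : 0 ≤ 1 - p := by linarith
  exact mul_le_mul_of_nonneg_left (hfg S (Finset.mem_powerset.1 hS)) (by positivity)

variable [DecidableEq α]

/-- The indicator of the subsets that contain `A` and avoid `B`. -/
noncomputable def cylinder (A B S : Finset α) : ℝ :=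
  if A ⊆ S ∧ Disjoint B S then 1 else 0

lemma expect_cylinder {R A B : Finset α} (p : ℝ) (hA : A ⊆ R) (hB : B ⊆ R)
    (hAB : Disjoint A B) :
    expect R p (cylinder A B) = p ^ A.card * (1 - p) ^ B.card := by
  have key := Finset.prod_add (fun i => if i ∈ B then (0 : ℝ) else p)
    (fun i => if i ∈ A then (0 : ℝ) else 1 - p) R
  have hprod : ∏ i ∈ R, ((if i ∈ B then (0 : ℝ) else p) + (if i ∈ A then (0 : ℝ) else 1 - p)) =
      p ^ A.card * (1 - p) ^ B.card := by
    have hfac : ∀ i ∈ R, ((if i ∈ B then (0 : ℝ) else p) + (if i ∈ A then (0 : ℝ) else 1 - p)) =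
        (if i ∈ A then p else 1) * (if i ∈ B then 1 - p else 1) := by
      intro i _
      by_cases ha : i ∈ A
      · simp [ha, Finset.disjoint_left.1 hAB ha]
      · by_cases hb : i ∈ B <;> simp [ha, hb]
    rw [Finset.prod_congr rfl hfac, Finset.prod_mul_distrib, Finset.prod_ite_mem,
      Finset.prod_ite_mem, Finset.inter_eq_right.2 hA, Finset.inter_eq_right.2 hB]
    simp
  rw [← hprod, key, expect]
  refine Finset.sum_congr rfl fun S hS => ?_
  have hSR := Finset.mem_powerset.1 hS
  rw [← Finset.card_sdiff_of_subset hSR, cylinder]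
  by_cases hAS : A ⊆ S
  · by_cases hBS : Disjoint B S
    · rw [if_pos ⟨hAS, hBS⟩, mul_one,
        Finset.prod_congr rfl (fun i hi => if_neg (Finset.disjoint_right.1 hBS hi)),
        Finset.prod_congr rfl
          (fun i hi => if_neg fun hiA => (Finset.mem_sdiff.1 hi).2 (hAS hiA))]
      simp
    · obtain ⟨i, hi, hi'⟩ := Finset.not_disjoint_iff.1 hBS
      rw [if_neg (fun h => hBS h.2), Finset.prod_eq_zero (f := fun i => if i ∈ B then (0 : ℝ) else p) hi' (if_pos hi)]
      simp
  · obtain ⟨i, hi, hi'⟩ := Finset.not_subset.1 hAS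
    rw [if_neg (fun h => hAS h.1),
      Finset.prod_eq_zero (i := i) (s := R \ S)
        (f := fun i => if i ∈ A then (0 : ℝ) else 1 - p) (Finset.mem_sdiff.2 ⟨hA hi, hi'⟩) (if_pos hi)]
    simp

lemma expect_one (R : Finset α) (p : ℝ) : expect R p (fun _ => 1) = 1 := by
  have := expect_cylinder (R := R) p (Finset.empty_subset R) (Finset.empty_subset R)
    (Finset.disjoint_empty_left ∅)
  have hc : cylinder (∅ : Finset α) ∅ = fun _ => 1 := by
    funext S
    simp [cylinder]
  simpa [hc] using this

lemma cylinder_mul (A B A' B' S : Finset α) :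
    cylinder A B S * cylinder A' B' S = cylinder (A ∪ A') (B ∪ B') S := by
  simp only [cylinder, Finset.union_subset_iff, Finset.disjoint_union_left]
  by_cases h : A ⊆ S ∧ Disjoint B S <;> by_cases h' : A' ⊆ S ∧ Disjoint B' S <;>
    simp only [h, h', if_false] <;> grind

/-- The variance of a sum of cylinder indicators with disjoint supports is at most its mean. -/
lemma expect_sq_sub_le {R : Finset α} {p : ℝ} (h0 : 0 ≤ p) (h1 : p ≤ 1)
    (I : Finset ι) (A B : ι → Finset α) (a b : ℕ)
    (hAR : ∀ i ∈ I, A i ⊆ R) (hBR : ∀ i ∈ I, B i ⊆ R)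
    (ha : ∀ i ∈ I, (A i).card = a) (hb : ∀ i ∈ I, (B i).card = b)
    (hAB : ∀ i ∈ I, ∀ j ∈ I, Disjoint (A i) (B j))
    (hAA : ∀ i ∈ I, ∀ j ∈ I, i ≠ j → Disjoint (A i) (A j))
    (hBB : ∀ i ∈ I, ∀ j ∈ I, i ≠ j → Disjoint (B i) (B j)) :
    expect R p (fun S => (∑ i ∈ I, cylinder (A i) (B i) S - I.card * (p ^ a * (1 - p) ^ b)) ^ 2)
      ≤ I.card * (p ^ a * (1 - p) ^ b) := by
  classical
  set r := p ^ a * (1 - p) ^ b with hr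
  have hr0 : 0 ≤ r := mul_nonneg (by positivity) (pow_nonneg (by linarith) _)
  have hone : ∀ i ∈ I, expect R p (cylinder (A i) (B i)) = r := fun i hi => by
    rw [expect_cylinder p (hAR i hi) (hBR i hi) (hAB i hi i hi), ha i hi, hb i hi]
  have htwo : ∀ i ∈ I, ∀ j ∈ I,
      expect R p (fun S => cylinder (A i) (B i) S * cylinder (A j) (B j) S)
        ≤ r ^ 2 + if i = j then r else 0 := by
    intro i hi j hj
    simp only [cylinder_mul]
    change expect R p (cylinder (A i ∪ A j) (B i ∪ B j)) ≤ _
    by_cases hij : i = j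
    · subst hij
      simp only [Finset.union_self, if_true]
      rw [hone i hi]
      nlinarith
    · rw [expect_cylinder p (Finset.union_subset (hAR i hi) (hAR j hj))
        (Finset.union_subset (hBR i hi) (hBR j hj)), Finset.card_union_of_disjoint (hAA i hi j hj hij),
        Finset.card_union_of_disjoint (hBB i hi j hj hij), ha i hi, ha j hj, hb i hi, hb j hj,
        if_neg hij, hr]
      · exact le_of_eq (by ring)
      · simp only [Finset.disjoint_union_left, Finset.disjoint_union_right]
        exact ⟨⟨hAB i hi i hi, hAB j hj i hi⟩, hAB i hi j hj, hAB j hj j hj⟩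
  have hexp : ∀ S, (∑ i ∈ I, cylinder (A i) (B i) S - I.card * r) ^ 2 =
      (∑ i ∈ I, ∑ j ∈ I, cylinder (A i) (B i) S * cylinder (A j) (B j) S) +
      ((-2 * (I.card * r)) * (∑ i ∈ I, cylinder (A i) (B i) S) + (I.card * r) ^ 2 * 1) := by
    intro S
    rw [← Finset.sum_mul_sum]
    ring
  simp only [hexp]
  rw [expect_add, expect_add, expect_const_mul, expect_const_mul, expect_one, expect_sum, expect_sum,
    Finset.sum_congr rfl hone]
  have hdouble : ∑ i ∈ I, expect R p
      (fun S => ∑ j ∈ I, cylinder (A i) (B i) S * cylinder (A j) (B j) S)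
      ≤ ∑ i ∈ I, ∑ j ∈ I, (r ^ 2 + if i = j then r else 0) := by
    refine Finset.sum_le_sum fun i hi => ?_
    rw [expect_sum]
    exact Finset.sum_le_sum fun j hj => htwo i hi j hj
  have hsum : ∑ i ∈ I, ∑ j ∈ I, (r ^ 2 + if i = j then r else 0) =
      I.card ^ 2 * r ^ 2 + I.card * r := by
    simp only [Finset.sum_add_distrib, Finset.sum_const, Finset.sum_ite_eq, nsmul_eq_mul]
    rw [Finset.sum_congr rfl (fun i hi => if_pos hi)]
    simp
    ring
  rw [hsum] at hdouble
  simp only [Finset.sum_const, nsmul_eq_mul]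
  nlinarith

end RandomSubset

section Geometry

/-- Primitive vectors of norm at most `n` in the octant `0 < y ≤ x`. -/
noncomputable def octant (n : ℕ) : Finset (ℤ × ℤ) :=
  (Finset.Icc (1 : ℤ) n ×ˢ Finset.Icc (1 : ℤ) n).filter
    fun u => u.2 ≤ u.1 ∧ IsCoprime u.1 u.2

lemma mem_octant {n : ℕ} {u : ℤ × ℤ} :
    u ∈ octant n ↔ 1 ≤ u.2 ∧ u.2 ≤ u.1 ∧ u.1 ≤ n ∧ IsCoprime u.1 u.2 := by
  simp only [octant, Finset.mem_filter, Finset.mem_product, Finset.mem_Icc]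
  constructor
  · rintro ⟨⟨⟨_, _⟩, _, _⟩, _, h⟩
    exact ⟨by omega, by omega, by omega, h⟩
  · rintro ⟨_, _, _, h⟩
    exact ⟨⟨⟨by omega, by omega⟩, by omega, by omega⟩, by omega, h⟩

lemma mem_rays {h : ℕ} {u : ℤ × ℤ} :
    u ∈ rays h ↔ (-(h : ℤ) ≤ u.1 ∧ u.1 ≤ h) ∧ (-(h : ℤ) ≤ u.2 ∧ u.2 ≤ h) ∧ Primitive u := by
  simp only [rays, Finset.mem_filter, Finset.mem_Icc, Prod.le_def]
  tauto

lemma octant_subset_rays (h : ℕ) : octant h ⊆ rays h := by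
  intro u hu
  obtain ⟨h1, h2, h3, h4⟩ := mem_octant.1 hu
  refine mem_rays.2 ⟨⟨by omega, by omega⟩, ⟨by omega, by omega⟩, ?_, Int.isCoprime_iff_gcd_eq_one.1 h4⟩
  rintro rfl
  simp at h1

lemma mem_octant_of_mem_rays {h : ℕ} {u : ℤ × ℤ} (hu : u ∈ rays h) (h1 : 0 < u.2)
    (h2 : u.2 ≤ u.1) : u ∈ octant h := by
  obtain ⟨h3, -, -, h5⟩ := mem_rays.1 hu
  exact mem_octant.2 ⟨h1, h2, h3.2, Int.isCoprime_iff_gcd_eq_one.2 h5⟩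

lemma octant_mono {m n : ℕ} (hmn : m ≤ n) : octant m ⊆ octant n := by
  intro u hu
  obtain ⟨h1, h2, h3, h4⟩ := mem_octant.1 hu
  exact mem_octant.2 ⟨h1, h2, by omega, h4⟩

lemma exists_eq_mul_of_det2_eq {n : ℕ} {u v w : ℤ × ℤ} (hu : u ∈ octant n)
    (h : det2 u v = det2 u w) : ∃ k : ℤ, v.1 = w.1 + k * u.1 ∧ v.2 = w.2 + k * u.2 := by
  obtain ⟨h1, h2, -, hc⟩ := mem_octant.1 hu
  simp only [det2] at h
  have hdvd : u.1 ∣ u.2 * (v.1 - w.1) := ⟨v.2 - w.2, by linarith⟩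
  obtain ⟨k, hk⟩ := hc.dvd_of_dvd_mul_left hdvd
  have h3 : u.1 ≠ 0 := by omega
  refine ⟨k, by linarith, mul_left_cancel₀ h3 ?_⟩
  have : v.1 = w.1 + u.1 * k := by linarith
  rw [this] at h
  linarith

lemma eq_of_det2_eq_zero {n : ℕ} {u v : ℤ × ℤ} (hu : u ∈ octant n) (hv : v ∈ octant n)
    (h : det2 u v = 0) : u = v := by
  obtain ⟨k, hk1, hk2⟩ := exists_eq_mul_of_det2_eq (w := 0) hu (by simpa [det2] using h)
  obtain ⟨h1, h2, -, hc⟩ := mem_octant.1 hv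
  obtain ⟨h1', h2', -, -⟩ := mem_octant.1 hu
  simp only [Prod.fst_zero, Prod.snd_zero, zero_add] at hk1 hk2
  have hk0 : 0 < k := by
    by_contra hk
    nlinarith
  have hunit : IsUnit k := hc.isUnit_of_dvd' ⟨u.1, hk1⟩ ⟨u.2, hk2⟩
  have : k = 1 := by
    rcases Int.isUnit_iff.1 hunit with h | h <;> omega
  subst this
  ext <;> omega

/-- Within an octant, a ray that is not the last one of `S` has a successor. -/
lemma exists_sAdj {h : ℕ} {S : Finset (ℤ × ℤ)} (hS : S ⊆ rays h) {u v : ℤ × ℤ}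
    (hu : u ∈ S ∩ octant h) (hv : v ∈ S ∩ octant h) (huv : 0 < det2 u v) :
    ∃ w ∈ S ∩ octant h, SAdj S u w := by
  obtain ⟨w, hw, hmin⟩ := Finset.exists_min_image
    ((S ∩ octant h).filter fun w => 0 < det2 u w) (fun w => (w.2 : ℝ) / w.1)
    ⟨v, Finset.mem_filter.2 ⟨hv, huv⟩⟩
  obtain ⟨hwS, hdet⟩ := Finset.mem_filter.1 hw
  refine ⟨w, hwS, (Finset.mem_inter.1 hu).1, (Finset.mem_inter.1 hwS).1, hdet, ?_⟩
  rintro x hxS ⟨a, b, ha, hb, h1, h2⟩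
  obtain ⟨hu1, hu2, -, -⟩ := mem_octant.1 (Finset.mem_inter.1 hu).2
  obtain ⟨hw1, hw2, -, -⟩ := mem_octant.1 (Finset.mem_inter.1 hwS).2
  have hu1' : (1 : ℝ) ≤ u.2 := by exact_mod_cast hu1
  have hu2' : (u.2 : ℝ) ≤ u.1 := by exact_mod_cast hu2
  have hw1' : (1 : ℝ) ≤ w.2 := by exact_mod_cast hw1
  have hw2' : (w.2 : ℝ) ≤ w.1 := by exact_mod_cast hw2
  have hdet' : (0 : ℝ) < u.1 * w.2 - u.2 * w.1 := by
    have : (0 : ℝ) < (det2 u w : ℤ) := by exact_mod_cast hdet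
    simpa [det2] using this
  have hx1 : (0 : ℝ) < x.2 := by rw [h2]; positivity
  have hx2 : (x.2 : ℝ) ≤ x.1 := by rw [h1, h2]; gcongr
  have hxO : x ∈ octant h :=
    mem_octant_of_mem_rays (hS hxS) (by exact_mod_cast hx1) (by exact_mod_cast hx2)
  have hxdet : 0 < det2 u x := by
    have : (0 : ℝ) < (det2 u x : ℤ) := by
      simp only [det2, Int.cast_sub, Int.cast_mul]
      rw [h1, h2]
      have := mul_pos hb hdet'
      linarith
    exact_mod_cast this
  have hle := hmin x (Finset.mem_filter.2 ⟨Finset.mem_inter.2 ⟨hxS, hxO⟩, hxdet⟩)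
  rw [div_le_div_iff₀ (by linarith) (by linarith), h1, h2] at hle
  have := mul_pos ha hdet'
  linarith

/-- Pairs of rays of the octant spanning a smooth cone. -/
noncomputable def unimodularPairs (h : ℕ) : Finset ((ℤ × ℤ) × (ℤ × ℤ)) :=
  (octant h ×ˢ octant h).filter fun x => det2 x.1 x.2 = 1

lemma card_unimodularPairs_le (h : ℕ) : (unimodularPairs h).card ≤ h ^ 2 := by
  have hcard : (Finset.Icc (1 : ℤ) h ×ˢ Finset.Icc (1 : ℤ) h).card = h ^ 2 := by
    simp [sq]
  rw [← hcard]
  refine Finset.card_le_card_of_injOn (fun x => (x.1.1, x.2.1)) ?_ ?_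
  · rintro ⟨u, v⟩ hx
    simp only [unimodularPairs, Finset.coe_filter, Finset.mem_product, Set.mem_ofPred_eq] at hx
    obtain ⟨h1, h2, h3, -⟩ := mem_octant.1 hx.1.1
    obtain ⟨h1', h2', h3', -⟩ := mem_octant.1 hx.1.2
    simp only [Finset.coe_product, Set.mem_prod, Finset.coe_Icc, Set.mem_Icc]
    omega
  · rintro ⟨⟨a, b⟩, ⟨x, y⟩⟩ hx ⟨⟨a', b'⟩, ⟨x', y'⟩⟩ hx' heq
    replace hx := Finset.mem_filter.1 (Finset.mem_coe.1 hx)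
    replace hx' := Finset.mem_filter.1 (Finset.mem_coe.1 hx')
    simp only [Finset.mem_product, mem_octant, det2] at hx hx'
    simp only [Prod.mk.injEq] at heq
    obtain ⟨rfl, rfl⟩ := heq
    obtain ⟨⟨⟨h1, h2, -, -⟩, -⟩, h3⟩ := hx
    obtain ⟨⟨⟨h1', h2', -, -⟩, -⟩, h3'⟩ := hx'
    have hc : IsCoprime a x := ⟨y, -b, by linarith⟩
    have hdvd : a ∣ x * (b - b') := ⟨y - y', by linarith⟩
    have hb : b - b' = 0 := Int.eq_zero_of_abs_lt_dvd (hc.dvd_of_dvd_mul_left hdvd)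
      (by rw [abs_lt]; omega)
    obtain rfl : b = b' := by omega
    obtain rfl : y = y' := mul_left_cancel₀ (show a ≠ 0 by omega) (by linarith)
    rfl

/-- `S` has no singular adjacent pair. -/
def Smooth (S : Finset (ℤ × ℤ)) : Prop := ¬ ∃ u v : ℤ × ℤ, SAdj S u v ∧ 2 ≤ det2 u v

lemma Smooth.exists_det2_eq_one {h : ℕ} {S : Finset (ℤ × ℤ)} (hs : Smooth S) (hS : S ⊆ rays h)
    {u v : ℤ × ℤ} (hu : u ∈ S ∩ octant h) (hv : v ∈ S ∩ octant h) (huv : 0 < det2 u v) :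
    ∃ w ∈ S ∩ octant h, det2 u w = 1 := by
  obtain ⟨w, hw, hadj⟩ := exists_sAdj hS hu hv huv
  refine ⟨w, hw, ?_⟩
  have h1 := hadj.2.2.1
  have h2 : ¬ 2 ≤ det2 u w := fun h2 => hs ⟨u, w, hadj, h2⟩
  omega

/-- A smooth fan has at least as many unimodular pairs as rays in the octant, minus one. -/
lemma Smooth.card_inter_octant_le {h : ℕ} {S : Finset (ℤ × ℤ)} (hs : Smooth S)
    (hS : S ⊆ rays h) :
    (S ∩ octant h).card ≤
      ((unimodularPairs h).filter fun x => x.1 ∈ S ∧ x.2 ∈ S).card + 1 := by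
  classical
  have hlast : ((S ∩ octant h).filter fun u => ¬ ∃ v ∈ S ∩ octant h, 0 < det2 u v).card ≤ 1 := by
    refine Finset.card_le_one.2 fun u hu v hv => ?_
    obtain ⟨hu, hu'⟩ := Finset.mem_filter.1 hu
    obtain ⟨hv, hv'⟩ := Finset.mem_filter.1 hv
    push Not at hu' hv'
    have h1 := hu' v hv
    have h2 := hv' u hu
    refine eq_of_det2_eq_zero (Finset.mem_inter.1 hu).2 (Finset.mem_inter.1 hv).2 ?_
    simp only [det2] at *
    linarith
  have hinit : ((S ∩ octant h).filter fun u => ∃ v ∈ S ∩ octant h, 0 < det2 u v).card ≤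
      ((unimodularPairs h).filter fun x => x.1 ∈ S ∧ x.2 ∈ S).card := by
    refine le_trans (Finset.card_le_card ?_)
      (Finset.card_image_le (f := fun x : (ℤ × ℤ) × (ℤ × ℤ) => x.1))
    intro u hu
    obtain ⟨hu, v, hv, huv⟩ := Finset.mem_filter.1 hu
    obtain ⟨w, hw, hdet⟩ := hs.exists_det2_eq_one hS hu hv huv
    rw [Finset.mem_inter] at hu hw
    exact Finset.mem_image.2 ⟨(u, w), Finset.mem_filter.2
      ⟨Finset.mem_filter.2 ⟨Finset.mem_product.2 ⟨hu.2, hw.2⟩, hdet⟩, hu.1, hw.1⟩, rfl⟩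
  rw [← Finset.card_filter_add_card_filter_not (s := S ∩ octant h)
    (fun u => ∃ v ∈ S ∩ octant h, 0 < det2 u v)]
  omega

/-- Each short ray `w` has a long predecessor `u` in the fan of all rays of norm at most `h`. -/
lemma exists_predecessor {h : ℕ} {w : ℤ × ℤ} (hw : w ∈ octant (h / 2)) :
    ∃ u ∈ octant h, det2 u w = 1 ∧ (h : ℤ) < u.1 + w.1 := by
  obtain ⟨h1, h2, h3, s, t, hst⟩ := mem_octant.1 hw
  have hpos : 0 < w.1 := by omega
  set k := ((h : ℤ) - t) / w.1 with hk
  have hlo : k * w.1 ≤ h - t := Int.ediv_mul_le _ hpos.ne'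
  have hhi : (h : ℤ) - t < (k + 1) * w.1 := Int.lt_ediv_add_one_mul_self _ hpos
  have hdet : det2 (t + k * w.1, k * w.2 - s) w = 1 := by
    simp only [det2]
    linarith
  have hh : w.1 * 2 ≤ h := by omega
  simp only [det2] at hdet
  refine ⟨(t + k * w.1, k * w.2 - s), mem_octant.2 ⟨?_, ?_, ?_, ?_⟩, hdet, ?_⟩
  · dsimp only
    by_contra hneg
    nlinarith
  · dsimp only
    by_contra hneg
    nlinarith
  · dsimp only
    linarith
  · exact ⟨w.2, -w.1, by dsimp only; linarith⟩
  · dsimp only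
    linarith

/-- A smooth fan cannot omit two short rays while containing their long predecessors. -/
lemma Smooth.eq_of_predecessors {h : ℕ} {S : Finset (ℤ × ℤ)} (hs : Smooth S) (hS : S ⊆ rays h)
    {u w u' w' : ℤ × ℤ} (hw : w ∈ octant (h / 2)) (hw' : w' ∈ octant (h / 2))
    (hu : u ∈ S ∩ octant h) (hu' : u' ∈ S ∩ octant h) (hwS : w ∉ S) (hwS' : w' ∉ S)
    (hdet : det2 u w = 1) (hdet' : det2 u' w' = 1)
    (hlt : (h : ℤ) < u.1 + w.1) (hlt' : (h : ℤ) < u'.1 + w'.1) : u = u' := by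
  have key : ∀ {u w u' : ℤ × ℤ}, w ∈ octant (h / 2) → u ∈ S ∩ octant h → u' ∈ S ∩ octant h →
      w ∉ S → det2 u w = 1 → (h : ℤ) < u.1 + w.1 → det2 u u' ≤ 0 := by
    intro u w u' hw hu hu' hwS hdet hlt
    by_contra hpos
    obtain ⟨v, hv, hdv⟩ := hs.exists_det2_eq_one hS hu hu' (by omega)
    obtain ⟨k, hk1, hk2⟩ :=
      exists_eq_mul_of_det2_eq (Finset.mem_inter.1 hu).2 (hdv.trans hdet.symm)
    obtain ⟨hv1, hv2, hv3, -⟩ := mem_octant.1 (Finset.mem_inter.1 hv).2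
    obtain ⟨hw1, hw2, hw3, -⟩ := mem_octant.1 hw
    rcases lt_trichotomy k 0 with hk | hk | hk
    · have : k * u.1 ≤ -1 * u.1 := mul_le_mul_of_nonneg_right (by omega) (by omega)
      omega
    · subst hk
      have : v = w := by ext <;> linarith
      exact hwS (this ▸ (Finset.mem_inter.1 hv).1)
    · have : 1 * u.1 ≤ k * u.1 := mul_le_mul_of_nonneg_right (by omega) (by omega)
      omega
  have h1 := key hw hu hu' hwS hdet hlt
  have h2 := key hw' hu' hu hwS' hdet' hlt'
  refine eq_of_det2_eq_zero (Finset.mem_inter.1 hu).2 (Finset.mem_inter.1 hu').2 ?_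
  simp only [det2] at *
  linarith

lemma eq_of_common_predecessor {h : ℕ} {u w w' : ℤ × ℤ} (hu : u ∈ octant h)
    (hw : w ∈ octant (h / 2)) (hw' : w' ∈ octant (h / 2))
    (hdet : det2 u w = 1) (hdet' : det2 u w' = 1) (hlt : (h : ℤ) < u.1 + w.1) : w = w' := by
  obtain ⟨k, hk1, hk2⟩ := exists_eq_mul_of_det2_eq hu (hdet.trans hdet'.symm)
  obtain ⟨hw1, hw2, hw3, -⟩ := mem_octant.1 hw
  obtain ⟨hw1', hw2', hw3', -⟩ := mem_octant.1 hw'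
  rcases lt_trichotomy k 0 with hk | hk | hk
  · have : k * u.1 ≤ -1 * u.1 := mul_le_mul_of_nonneg_right (by omega) (by omega)
    omega
  · subst hk
    ext <;> linarith
  · have : 1 * u.1 ≤ k * u.1 := mul_le_mul_of_nonneg_right (by omega) (by omega)
    omega

end Geometry

section Counting

lemma sum_Icc_inv_sq_le {n : ℕ} : ∑ d ∈ Finset.Icc 2 n, ((d : ℝ) ^ 2)⁻¹ ≤ 3 / 4 := by
  rcases lt_or_ge n 2 with hn | hn
  · rw [Finset.Icc_eq_empty (by omega)]
    norm_num
  · have h := sum_Ioc_inv_sq_le_sub (α := ℝ) two_ne_zero hn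
    have h' : Finset.Icc 2 n = insert 2 (Finset.Ioc 2 n) := by
      ext; simp only [Finset.mem_Icc, Finset.mem_insert, Finset.mem_Ioc]; omega
    rw [h', Finset.sum_insert (by simp)]
    have : (0 : ℝ) ≤ (n : ℝ)⁻¹ := by positivity
    norm_num at h ⊢
    linarith

/-- At least a quarter of the pairs in a square are coprime. -/
lemma card_coprime_square_ge (n : ℕ) :
    (n : ℝ) ^ 2 / 4 ≤
      ((Finset.Icc 1 n ×ˢ Finset.Icc 1 n).filter fun x : ℕ × ℕ => x.1.Coprime x.2).card := by
  set T := Finset.Icc 1 n ×ˢ Finset.Icc 1 n with hT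
  have hTc : T.card = n ^ 2 := by simp [hT, sq]
  have hsplit := Finset.card_filter_add_card_filter_not (s := T)
    (fun x : ℕ × ℕ => x.1.Coprime x.2)
  have hsub : (T.filter fun x : ℕ × ℕ => ¬ x.1.Coprime x.2) ⊆
      (Finset.Icc 2 n).biUnion fun d =>
        (Finset.Icc 1 (n / d) ×ˢ Finset.Icc 1 (n / d)).image fun x => (d * x.1, d * x.2) := by
    rintro ⟨x, y⟩ hx
    simp only [hT, Finset.mem_filter, Finset.mem_product, Finset.mem_Icc] at hx
    obtain ⟨⟨⟨hx1, hxn⟩, hy1, hyn⟩, hc⟩ := hx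
    have hgpos : 0 < Nat.gcd x y := Nat.gcd_pos_of_pos_left _ hx1
    have hgx := Nat.gcd_dvd_left x y
    have hgy := Nat.gcd_dvd_right x y
    have hg2 : 2 ≤ Nat.gcd x y := by
      have : Nat.gcd x y ≠ 1 := hc
      omega
    simp only [Finset.mem_biUnion, Finset.mem_image, Finset.mem_product, Finset.mem_Icc]
    refine ⟨Nat.gcd x y, ⟨hg2, (Nat.le_of_dvd hx1 hgx).trans hxn⟩,
      (x / Nat.gcd x y, y / Nat.gcd x y),
      ⟨⟨Nat.div_pos (Nat.le_of_dvd hx1 hgx) hgpos, Nat.div_le_div_right hxn⟩,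
        Nat.div_pos (Nat.le_of_dvd hy1 hgy) hgpos, Nat.div_le_div_right hyn⟩, ?_⟩
    dsimp only
    rw [Nat.mul_div_cancel' hgx, Nat.mul_div_cancel' hgy]
  have hle : ((T.filter fun x : ℕ × ℕ => ¬ x.1.Coprime x.2).card : ℝ) ≤ n ^ 2 * (3 / 4) := by
    calc ((T.filter fun x : ℕ × ℕ => ¬ x.1.Coprime x.2).card : ℝ)
        ≤ ((∑ d ∈ Finset.Icc 2 n, (n / d) * (n / d) : ℕ) : ℝ) := by
          refine Nat.cast_le.2 (((Finset.card_le_card hsub).trans Finset.card_biUnion_le).trans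
            (Finset.sum_le_sum fun d _ => Finset.card_image_le.trans ?_))
          simp
      _ ≤ ∑ d ∈ Finset.Icc 2 n, (n : ℝ) ^ 2 * ((d : ℝ) ^ 2)⁻¹ := by
          push_cast
          refine Finset.sum_le_sum fun d _ => ?_
          rw [← sq, ← div_eq_mul_inv, ← div_pow]
          exact pow_le_pow_left₀ (by positivity) Nat.cast_div_le 2
      _ ≤ _ := by
          rw [← Finset.mul_sum]
          exact mul_le_mul_of_nonneg_left sum_Icc_inv_sq_le (by positivity)
  have hsplit' : ((T.filter fun x : ℕ × ℕ => x.1.Coprime x.2).card : ℝ) +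
      (T.filter fun x : ℕ × ℕ => ¬ x.1.Coprime x.2).card = n ^ 2 := by
    rw [hTc] at hsplit
    exact_mod_cast hsplit
  linarith

lemma card_octant_ge (n : ℕ) : (n : ℝ) ^ 2 / 8 ≤ (octant n).card := by
  have h := card_coprime_square_ge n
  have hle : ((Finset.Icc 1 n ×ˢ Finset.Icc 1 n).filter
      fun x : ℕ × ℕ => x.1.Coprime x.2).card ≤ (octant n).card + (octant n).card := by
    calc _ ≤ (octant n ∪ (octant n).image Prod.swap).card := by
          refine Finset.card_le_card_of_injOn (fun x => ((x.1 : ℤ), (x.2 : ℤ))) ?_ ?_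
          · rintro ⟨x, y⟩ hx
            simp only [Finset.coe_filter, Finset.mem_product, Finset.mem_Icc,
              Set.mem_ofPred_eq] at hx
            have hc : IsCoprime (x : ℤ) (y : ℤ) := Nat.isCoprime_iff_coprime.2 hx.2
            rw [Finset.mem_coe, Finset.mem_union]
            rcases le_total y x with hxy | hxy
            · exact Or.inl (mem_octant.2 ⟨by dsimp only; omega, by dsimp only; omega,
                by dsimp only; omega, hc⟩)
            · exact Or.inr (Finset.mem_image.2 ⟨((y : ℤ), (x : ℤ)), mem_octant.2
                ⟨by dsimp only; omega, by dsimp only; omega, by dsimp only; omega, hc.symm⟩, rfl⟩)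
          · rintro ⟨x, y⟩ - ⟨x', y'⟩ - hxy
            simpa using hxy
      _ ≤ _ := (Finset.card_union_le _ _).trans (Nat.add_le_add_left Finset.card_image_le _)
  have hle' : (((Finset.Icc 1 n ×ˢ Finset.Icc 1 n).filter
      fun x : ℕ × ℕ => x.1.Coprime x.2).card : ℝ) ≤ (octant n).card + (octant n).card := by
    exact_mod_cast hle
  linarith

end Counting

section Probability

open Classical in
/-- The probability that the random fan is smooth. -/
noncomputable def smoothProb (h : ℕ) (p : ℝ) : ℝ :=
  expect (rays h) p fun S => if Smooth S then 1 else 0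

lemma prob_singular_eq (h : ℕ) (p : ℝ) :
    prob h p (fun S => ∃ u v : ℤ × ℤ, SAdj S u v ∧ 2 ≤ det2 u v) = 1 - smoothProb h p := by
  classical
  rw [eq_sub_iff_add_eq, ← expect_one (rays h) p, smoothProb, prob, expect, expect,
    ← Finset.sum_add_distrib]
  refine Finset.sum_congr rfl fun S _ => ?_
  by_cases hS : ∃ u v : ℤ × ℤ, SAdj S u v ∧ 2 ≤ det2 u v
  · rw [if_pos hS, if_neg (fun hs : Smooth S => hs hS), mul_zero, add_zero, mul_one]
  · rw [if_neg hS, if_pos (show Smooth S from hS), zero_add]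

lemma smoothProb_nonneg (h : ℕ) {p : ℝ} (h0 : 0 ≤ p) (h1 : p ≤ 1) : 0 ≤ smoothProb h p := by
  have h1' : 0 ≤ 1 - p := by linarith
  refine Finset.sum_nonneg fun S _ => mul_nonneg (by positivity) ?_
  dsimp only
  split_ifs <;> norm_num

/-- A first and second moment bound, effective when rays are kept with small probability. -/
lemma smoothProb_le_of_sparse {h : ℕ} {p : ℝ} (h0 : 0 ≤ p) (h1 : p ≤ 1)
    (hp : 4 ≤ (octant h).card * p) :
    smoothProb h p ≤ 4 / ((octant h).card * p) + 4 * ((h : ℝ) ^ 2 * p ^ 2) / ((octant h).card * p) := by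
  classical
  set μ := ((octant h).card : ℝ) * p with hμ
  set Y : Finset (ℤ × ℤ) → ℝ := fun S => ∑ u ∈ octant h, cylinder {u} ∅ S with hY
  set X : Finset (ℤ × ℤ) → ℝ := fun S => ∑ x ∈ unimodularPairs h, cylinder {x.1, x.2} ∅ S with hX
  have hYcard : ∀ S, Y S = ((S ∩ octant h).card : ℝ) := by
    intro S
    simp only [hY, cylinder, Finset.disjoint_empty_left, and_true, Finset.singleton_subset_iff]
    rw [Finset.sum_boole, Finset.filter_mem_eq_inter, Finset.inter_comm]
  have hXcard : ∀ S, X S = (((unimodularPairs h).filter fun x => x.1 ∈ S ∧ x.2 ∈ S).card : ℝ) := by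
    intro S
    simp only [hX, cylinder, Finset.disjoint_empty_left, and_true, Finset.insert_subset_iff,
      Finset.singleton_subset_iff]
    rw [Finset.sum_boole]
  have hvar : expect (rays h) p (fun S => (Y S - μ) ^ 2) ≤ μ := by
    have := expect_sq_sub_le (R := rays h) h0 h1 (octant h) (fun u => {u}) (fun _ => ∅) 1 0
      (fun u hu => Finset.singleton_subset_iff.2 (octant_subset_rays h hu)) (by simp) (by simp)
      (by simp) (by simp) (fun u _ v _ huv => by simpa using huv) (by simp)
    simpa [hμ, hY] using this
  have hmean : expect (rays h) p X ≤ (h : ℝ) ^ 2 * p ^ 2 := by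
    rw [hX, expect_sum]
    have heach : ∀ x ∈ unimodularPairs h,
        expect (rays h) p (fun S => cylinder {x.1, x.2} ∅ S) = p ^ 2 := by
      intro x hx
      obtain ⟨hx, hdet⟩ := Finset.mem_filter.1 hx
      obtain ⟨hx1, hx2⟩ := Finset.mem_product.1 hx
      have hne : x.1 ≠ x.2 := by
        intro heq
        rw [heq] at hdet
        simp only [det2] at hdet
        linarith [mul_comm x.2.1 x.2.2]
      change expect (rays h) p (cylinder {x.1, x.2} ∅) = _
      rw [expect_cylinder p ?_ (Finset.empty_subset _) (Finset.disjoint_empty_right _),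
        Finset.card_pair hne]
      · simp
      · simp only [Finset.insert_subset_iff, Finset.singleton_subset_iff]
        exact ⟨octant_subset_rays h hx1, octant_subset_rays h hx2⟩
    rw [Finset.sum_congr rfl heach, Finset.sum_const, nsmul_eq_mul]
    have := card_unimodularPairs_le h
    gcongr
    exact_mod_cast this
  have hμ0 : 0 < μ := by linarith
  have hpoint : ∀ S ⊆ rays h, (if Smooth S then (1 : ℝ) else 0) ≤
      4 / μ ^ 2 * (Y S - μ) ^ 2 + 4 / μ * X S := by
    intro S hS
    have hX0 : 0 ≤ X S := by rw [hXcard]; positivity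
    split_ifs with hs
    · have hle : Y S ≤ X S + 1 := by
        rw [hYcard, hXcard]
        exact_mod_cast hs.card_inter_octant_le hS
      rcases le_total (Y S) (μ / 2) with hc | hc
      · have h2 : 1 ≤ 4 / μ ^ 2 * (Y S - μ) ^ 2 := by
          rw [div_mul_eq_mul_div, le_div_iff₀ (by positivity)]
          nlinarith
        have : 0 ≤ 4 / μ * X S := by positivity
        linarith
      · have h2 : 1 ≤ 4 / μ * X S := by
          rw [div_mul_eq_mul_div, le_div_iff₀ hμ0]
          linarith
        have : 0 ≤ 4 / μ ^ 2 * (Y S - μ) ^ 2 := by positivity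
        linarith
    · positivity
  calc smoothProb h p
      ≤ expect (rays h) p (fun S => 4 / μ ^ 2 * (Y S - μ) ^ 2 + 4 / μ * X S) :=
        expect_mono h0 h1 hpoint
    _ = 4 / μ ^ 2 * expect (rays h) p (fun S => (Y S - μ) ^ 2) + 4 / μ * expect (rays h) p X := by
        rw [expect_add, expect_const_mul, expect_const_mul]
    _ ≤ 4 / μ ^ 2 * μ + 4 / μ * ((h : ℝ) ^ 2 * p ^ 2) := by gcongr
    _ = _ := by field_simp

/-- A second moment bound, effective when rays are kept with probability bounded below. -/
lemma smoothProb_le_of_dense {h : ℕ} {p : ℝ} (h0 : 0 ≤ p) (h1 : p ≤ 1)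
    (hp : 4 ≤ (octant (h / 2)).card * (p * (1 - p))) :
    smoothProb h p ≤ 4 / ((octant (h / 2)).card * (p * (1 - p))) := by
  classical
  set μ := ((octant (h / 2)).card : ℝ) * (p * (1 - p)) with hμ
  have hex : ∀ w : ℤ × ℤ, ∃ u : ℤ × ℤ, w ∈ octant (h / 2) →
      u ∈ octant h ∧ det2 u w = 1 ∧ (h : ℤ) < u.1 + w.1 := by
    intro w
    by_cases hw : w ∈ octant (h / 2)
    · obtain ⟨u, hu⟩ := exists_predecessor hw
      exact ⟨u, fun _ => hu⟩
    · exact ⟨0, fun hw' => absurd hw' hw⟩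
  choose pred hpred using hex
  have hinj : ∀ w ∈ octant (h / 2), ∀ w' ∈ octant (h / 2), pred w = pred w' → w = w' := by
    intro w hw w' hw' heq
    obtain ⟨hu, hd, hlt⟩ := hpred w hw
    refine eq_of_common_predecessor hu hw hw' hd ?_ hlt
    rw [heq]
    exact (hpred w' hw').2.1
  set Z : Finset (ℤ × ℤ) → ℝ := fun S => ∑ w ∈ octant (h / 2), cylinder {pred w} {w} S with hZ
  have hvar : expect (rays h) p (fun S => (Z S - μ) ^ 2) ≤ μ := by
    have := expect_sq_sub_le (R := rays h) h0 h1 (octant (h / 2)) (fun w => {pred w})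
      (fun w => {w}) 1 1
      (fun w hw => Finset.singleton_subset_iff.2 (octant_subset_rays h (hpred w hw).1))
      (fun w hw => Finset.singleton_subset_iff.2
        (octant_subset_rays h (octant_mono (Nat.div_le_self h 2) hw)))
      (by simp) (by simp) ?_
      (fun w hw w' hw' hne => Finset.disjoint_singleton.2 fun heq => hne (hinj w hw w' hw' heq))
      (fun w _ w' _ hne => Finset.disjoint_singleton.2 hne)
    · simpa [hμ, hZ] using this
    · intro w hw w' hw'
      refine Finset.disjoint_singleton.2 fun heq => ?_
      have hlt := (hpred w hw).2.2
      rw [heq] at hlt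
      have hb := (mem_octant.1 hw).2.2.1
      have hb' := (mem_octant.1 hw').2.2.1
      omega
  have hμ0 : 0 < μ := by linarith
  have hpoint : ∀ S ⊆ rays h, (if Smooth S then (1 : ℝ) else 0) ≤ 4 / μ ^ 2 * (Z S - μ) ^ 2 := by
    intro S hS
    split_ifs with hs
    · have hle : Z S ≤ 1 := by
        simp only [hZ, cylinder, Finset.singleton_subset_iff, Finset.disjoint_singleton_left]
        rw [Finset.sum_boole]
        have : ((octant (h / 2)).filter fun w => pred w ∈ S ∧ w ∉ S).card ≤ 1 := by
          refine Finset.card_le_one.2 fun w hw w' hw' => ?_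
          obtain ⟨hw, huS, hwS⟩ := Finset.mem_filter.1 hw
          obtain ⟨hw', huS', hwS'⟩ := Finset.mem_filter.1 hw'
          obtain ⟨hu, hd, hlt⟩ := hpred w hw
          obtain ⟨hu', hd', hlt'⟩ := hpred w' hw'
          exact hinj w hw w' hw' (hs.eq_of_predecessors hS hw hw' (Finset.mem_inter.2 ⟨huS, hu⟩)
            (Finset.mem_inter.2 ⟨huS', hu'⟩) hwS hwS' hd hd' hlt hlt')
        exact_mod_cast this
      rw [div_mul_eq_mul_div, le_div_iff₀ (by positivity)]
      nlinarith
    · positivity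
  calc smoothProb h p
      ≤ expect (rays h) p (fun S => 4 / μ ^ 2 * (Z S - μ) ^ 2) := expect_mono h0 h1 hpoint
    _ = 4 / μ ^ 2 * expect (rays h) p (fun S => (Z S - μ) ^ 2) := expect_const_mul ..
    _ ≤ 4 / μ ^ 2 * μ := by gcongr
    _ = _ := by field_simp

/-- If both `h² p` and `h² (1 - p)` are large, the random fan is unlikely to be smooth. -/
lemma exists_smoothProb_lt {δ : ℝ} (hδ : 0 < δ) :
    ∃ K : ℝ, ∀ h : ℕ, 2 ≤ h → ∀ p : ℝ, 0 ≤ p → p ≤ 1 → K ≤ (h : ℝ) ^ 2 * p →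
      K ≤ (h : ℝ) ^ 2 * (1 - p) → smoothProb h p < δ := by
  set ε := δ / 128 with hε
  have hε0 : 0 < ε := by positivity
  refine ⟨32 + 128 / δ + (288 + 576 / δ) / ε, fun h hh p h0 h1 hKp hKq => ?_⟩
  have hKε : 0 ≤ (288 + 576 / δ) / ε := by positivity
  have hKδ : 0 < 128 / δ := by positivity
  rcases le_total p ε with hpε | hpε
  · have hcard := card_octant_ge h
    have hlow : (h : ℝ) ^ 2 / 8 * p ≤ (octant h).card * p := by gcongr
    have hh0 : 0 < (h : ℝ) ^ 2 := by positivity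
    have hp0 : 0 < p := by
      by_contra hneg
      have : p = 0 := by linarith
      rw [this] at hKp
      linarith
    have hlow0 : 0 < (h : ℝ) ^ 2 / 8 * p := by positivity
    refine (smoothProb_le_of_sparse h0 h1 (by linarith)).trans_lt ?_
    have hfst : 4 / ((octant h).card * p) ≤ δ / 4 := by
      calc 4 / ((octant h).card * p) ≤ 4 / (16 / δ) := by
            gcongr
            have : 16 / δ = 128 / δ / 8 := by ring
            linarith
        _ = δ / 4 := by field_simp; norm_num
    have hsnd : 4 * ((h : ℝ) ^ 2 * p ^ 2) / ((octant h).card * p) ≤ δ / 4 := by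
      calc 4 * ((h : ℝ) ^ 2 * p ^ 2) / ((octant h).card * p)
          ≤ 4 * ((h : ℝ) ^ 2 * p ^ 2) / ((h : ℝ) ^ 2 / 8 * p) := by gcongr
        _ = 32 * p := by field_simp; norm_num
        _ ≤ δ / 4 := by linarith
    linarith
  · have hcard := card_octant_ge (h / 2)
    have hhalf : (h : ℝ) / 3 ≤ (h / 2 : ℕ) := by
      have : h ≤ 3 * (h / 2) := by omega
      have : (h : ℝ) ≤ 3 * (h / 2 : ℕ) := by exact_mod_cast this
      linarith
    have hsq : ((h : ℝ) / 3) ^ 2 ≤ ((h / 2 : ℕ) : ℝ) ^ 2 := by gcongr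
    have hq0 : 0 ≤ 1 - p := by linarith
    have hlow : 4 + 8 / δ ≤ (octant (h / 2)).card * (p * (1 - p)) := by
      calc 4 + 8 / δ = ((288 + 576 / δ) / ε) / 72 * ε := by field_simp; ring
        _ ≤ ((h : ℝ) ^ 2 * (1 - p)) / 72 * p := by gcongr; linarith
        _ = ((h : ℝ) / 3) ^ 2 / 8 * (p * (1 - p)) := by ring
        _ ≤ (octant (h / 2)).card * (p * (1 - p)) := by
          gcongr
          linarith
    have hδ8 : 0 < 8 / δ := by positivity
    refine (smoothProb_le_of_dense h0 h1 (by linarith)).trans_lt ?_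
    calc 4 / ((octant (h / 2)).card * (p * (1 - p))) ≤ 4 / (8 / δ) := by
          gcongr
          linarith
      _ = δ / 2 := by field_simp; norm_num
      _ < δ := by linarith

end Probability

/-- Main Theorem, part 2 (singularity threshold): if `h²·q(h) → ∞` and
`h²·(1 − q(h)) → ∞`, then with high probability a random fan from `T(h, 1 − q(h))`
gives a singular toric surface. -/
theorem singular_threshold (q : ℕ → ℝ) (hq : ∀ h, 0 ≤ q h ∧ q h ≤ 1)
    (h1 : Tendsto (fun h : ℕ => (h : ℝ) ^ 2 * q h) atTop atTop)
    (h2 : Tendsto (fun h : ℕ => (h : ℝ) ^ 2 * (1 - q h)) atTop atTop) :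
    Tendsto (fun h : ℕ =>
        prob h (1 - q h) (fun S => ∃ u v : ℤ × ℤ, SAdj S u v ∧ 2 ≤ det2 u v))
      atTop (nhds 1) := by
  have hsmooth : Tendsto (fun h : ℕ => smoothProb h (1 - q h)) atTop (nhds 0) := by
    rw [Metric.tendsto_nhds]
    intro δ hδ
    obtain ⟨K, hK⟩ := exists_smoothProb_lt hδ
    filter_upwards [h1.eventually_ge_atTop K, h2.eventually_ge_atTop K, eventually_ge_atTop 2]
      with h hq1 hq2 hh
    have hp0 : 0 ≤ 1 - q h := by linarith [(hq h).2]
    have hp1 : 1 - q h ≤ 1 := by linarith [(hq h).1]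
    rw [Real.dist_eq, sub_zero, abs_of_nonneg (smoothProb_nonneg h hp0 hp1)]
    exact hK h hh _ hp0 hp1 hq2 (by rwa [sub_sub_cancel])
  simpa only [prob_singular_eq, sub_zero] using hsmooth.const_sub 1
end
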